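/- Let Π ⊊ Σ_k be a proper subshift and T : Π → Σ_k the map constructed from Π. Then for every y ∈ Π one has ω_{B*}(T(y)) ⊆ Π ⊊ ω_σ(T(y)); in particular, T(y) is recurrent but not Banach recurrent in (Σ_k, σ). -/

import Mathlib

open Filter Topology MeasureTheory

/-- Upper density of a set of naturals. -/
noncomputable def upperDensity (S : Set ℕ) : ℝ :=
  Filter.limsup (fun n => ((S ∩ Set.Iio n).ncard : ℝ) / n) Filter.atTop

/-- Lower density of a set of naturals. -/
noncomputable def lowerDensity (S : Set ℕ) : ℝ :=
  Filter.liminf (fun n => ((S ∩ Set.Iio n).ncard : ℝ) / n) Filter.atTop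

/-- Banach upper density: limsup over the interval length of the maximal
proportion of `S` in an interval of that length. -/
noncomputable def banachUpperDensity (S : Set ℕ) : ℝ :=
  Filter.limsup (fun N => ⨆ a : ℕ, ((S ∩ Set.Ico a (a + N)).ncard : ℝ) / N) Filter.atTop

/-- Banach lower density. -/
noncomputable def banachLowerDensity (S : Set ℕ) : ℝ :=
  Filter.liminf (fun N => ⨅ a : ℕ, ((S ∩ Set.Ico a (a + N)).ncard : ℝ) / N) Filter.atTop

/-- The shift map on the full shift `Σ_k = {0, …, k-1}^ℕ`. -/
def shift {k : ℕ} (x : ℕ → Fin k) : ℕ → Fin k := fun n => x (n + 1)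

/-- The metric `d(x,y) = Σ_{n ≥ 1} δ(x_n, y_n)/2^n` on `Σ_k` (sequences indexed from `0`). -/
noncomputable def shiftDist {k : ℕ} (x y : ℕ → Fin k) : ℝ :=
  ∑' n : ℕ, if x n = y n then 0 else (1 / 2) ^ (n + 1)

/-- The open ball `B_ε(x)` for the metric `shiftDist`. -/
def sball {k : ℕ} (x : ℕ → Fin k) (ε : ℝ) : Set (ℕ → Fin k) := {y | shiftDist x y < ε}

/-- `N(x, U) = {n ≥ 1 : σ^n(x) ∈ U}`. -/
def visits {k : ℕ} (x : ℕ → Fin k) (U : Set (ℕ → Fin k)) : Set ℕ :=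
  {n | 1 ≤ n ∧ shift^[n] x ∈ U}

/-- A point is recurrent if `N(x, B_ε(x)) ≠ ∅` for every `ε > 0`. -/
def Recurrent {k : ℕ} (x : ℕ → Fin k) : Prop := ∀ ε > (0 : ℝ), (visits x (sball x ε)).Nonempty

/-- A point is Banach recurrent if `N(x, B_ε(x))` has positive Banach upper density
for every `ε > 0`. -/
def BanachRecurrent {k : ℕ} (x : ℕ → Fin k) : Prop :=
  ∀ ε > (0 : ℝ), 0 < banachUpperDensity (visits x (sball x ε))

/-- Statistical ω-limit set w.r.t. a density notion `ξ`:
`ω_ξ(x) = {y : ξ(N(x, B_ε(y))) > 0 for all ε > 0}`. -/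
def statOmega {k : ℕ} (ξ : Set ℕ → ℝ) (x : ℕ → Fin k) : Set (ℕ → Fin k) :=
  {y | ∀ ε > (0 : ℝ), 0 < ξ (visits x (sball y ε))}

/-- The usual ω-limit set of `x` under the shift. -/
def omegaLim {k : ℕ} (x : ℕ → Fin k) : Set (ℕ → Fin k) :=
  {y | ∀ ε > (0 : ℝ), ∀ N : ℕ, ∃ n ≥ N, shift^[n] x ∈ sball y ε}

/-- Density of a subset of `Σ_k` w.r.t. the metric `shiftDist`. -/
def ShiftDense {k : ℕ} (A : Set (ℕ → Fin k)) : Prop :=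
  ∀ x : ℕ → Fin k, ∀ ε > (0 : ℝ), ∃ y ∈ A, shiftDist x y < ε

/-- Closure of a subset of `Σ_k` w.r.t. the metric `shiftDist`. -/
def shiftClosure {k : ℕ} (A : Set (ℕ → Fin k)) : Set (ℕ → Fin k) :=
  {z | ∀ ε > (0 : ℝ), ∃ y ∈ A, shiftDist z y < ε}

/-- `Φ^{(n)}_{xy}(t)`: the proportion of times `0 ≤ i < n` with `d(σ^i x, σ^i y) < t`. -/
noncomputable def PhiN {k : ℕ} (x y : ℕ → Fin k) (n : ℕ) (t : ℝ) : ℝ :=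
  (({i | i < n ∧ shiftDist (shift^[i] x) (shift^[i] y) < t}).ncard : ℝ) / n

/-- A pair is DC1 (distributionally chaotic of type 1) if `Φ_{xy}(s) = 0` for some `s > 0`
and `Φ*_{xy}(t) = 1` for all `t > 0`. -/
def DC1Pair {k : ℕ} (x y : ℕ → Fin k) : Prop :=
  (∃ s > (0 : ℝ), Filter.liminf (fun n => PhiN x y n s) Filter.atTop = 0) ∧
  (∀ t > (0 : ℝ), Filter.limsup (fun n => PhiN x y n t) Filter.atTop = 1)

/-- A set with at least two points is DC1-scrambled if every pair of distinct points is DC1. -/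
def DC1Scrambled {k : ℕ} (S : Set (ℕ → Fin k)) : Prop :=
  S.Nontrivial ∧ ∀ x ∈ S, ∀ y ∈ S, x ≠ y → DC1Pair x y

/-- `strictOrEq true A B` means `A ⊊ B`; `strictOrEq false A B` means `A = B`. -/
def strictOrEq {α : Type*} (b : Bool) (A B : Set α) : Prop := if b then A ⊂ B else A = B

/-- The patterns of (strict ⊊ = `true` / equality = `false`) for the three inclusions
`ω_{B_*} ⊆ ω_{d̲} ⊆ ω_{d̄} ⊆ ω_{B*}` in Cases (1)–(6). -/
def caseFlags : Fin 6 → Bool × Bool × Bool :=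
  ![(true, false, false), (true, false, true), (false, true, false),
    (true, true, false), (false, true, true), (true, true, true)]

/-- `x` satisfies Case (i), i = 1,…,6: the chain
`ω_{B_*}(x) ⊆ ω_{d̲}(x) ⊆ ω_{d̄}(x) ⊆ ω_{B*}(x) = ω_σ(x)` with strictness pattern given by
`caseFlags i`, and the last inclusion an equality. -/
def SatCase {k : ℕ} (i : Fin 6) (x : ℕ → Fin k) : Prop :=
  strictOrEq (caseFlags i).1 (statOmega banachLowerDensity x) (statOmega lowerDensity x) ∧
  strictOrEq (caseFlags i).2.1 (statOmega lowerDensity x) (statOmega upperDensity x) ∧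
  strictOrEq (caseFlags i).2.2 (statOmega upperDensity x) (statOmega banachUpperDensity x) ∧
  statOmega banachUpperDensity x = omegaLim x

/-- `x` satisfies Case (i'), i = 1,…,6: as in Case (i) but the last inclusion
`ω_{B*}(x) ⊆ ω_σ(x)` is strict. -/
def SatCase' {k : ℕ} (i : Fin 6) (x : ℕ → Fin k) : Prop :=
  strictOrEq (caseFlags i).1 (statOmega banachLowerDensity x) (statOmega lowerDensity x) ∧
  strictOrEq (caseFlags i).2.1 (statOmega lowerDensity x) (statOmega upperDensity x) ∧
  strictOrEq (caseFlags i).2.2 (statOmega upperDensity x) (statOmega banachUpperDensity x) ∧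
  statOmega banachUpperDensity x ⊂ omegaLim x
/-- A subshift: a nonempty, closed (w.r.t. the metric `shiftDist`), shift-invariant subset. -/
def IsSubshift {k : ℕ} (P : Set (ℕ → Fin k)) : Prop :=
  P.Nonempty ∧ shiftClosure P ⊆ P ∧ ∀ x ∈ P, shift x ∈ P

/-- The first `n` symbols of `y` as a finite word. -/
def prefixWord {k : ℕ} (y : ℕ → Fin k) (n : ℕ) : List (Fin k) :=
  List.ofFn (fun i : Fin n => y i)

/-- A finite word occurs in (the language of) `P` if it is the initial word of
some point of `P`. -/
def IsWordIn {k : ℕ} (w : List (Fin k)) (P : Set (ℕ → Fin k)) : Prop :=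
  ∃ x ∈ P, ∀ i : Fin w.length, x i = w.get i

/-- Data for the construction of the map `T`: an enumeration `C` of all (nonempty) finite
words of the subshift `P`, and a nonempty finite word `A1` not occurring in `P`. -/
structure TData (k : ℕ) (P : Set (ℕ → Fin k)) where
  C : ℕ → List (Fin k)
  A1 : List (Fin k)
  A1_ne : A1 ≠ []
  A1_not : ¬ IsWordIn A1 P
  C_in : ∀ n, IsWordIn (C n) P
  C_surj : ∀ w : List (Fin k), w ≠ [] → IsWordIn w P → ∃ n, C n = w

/-- The words `A_n` of the construction (indexed from `0`, so `TData.A y 0` is the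
paper's `A_1`): `A_{n+1} = A_n B_n A_n`, where `B_n = C_n Y_n ⋯ Y_n` consists of the
word `C_n` followed by `|A_n|²` copies of the initial word `Y_n` of `y` (paper's `Y_n`,
of length `n`, is `prefixWord y (n+1)` in our `0`-based indexing). -/
def TData.A {k : ℕ} {P : Set (ℕ → Fin k)} (D : TData k P) (y : ℕ → Fin k) :
    ℕ → List (Fin k)
  | 0 => D.A1
  | n + 1 =>
      D.A y n ++
        (D.C n ++ (List.replicate ((D.A y n).length ^ 2) (prefixWord y (n + 1))).flatten) ++
        D.A y n

/-- The requirement `|C_n| = o(|A_n|)` as `n → ∞`. -/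
def TData.Small {k : ℕ} {P : Set (ℕ → Fin k)} (D : TData k P) : Prop :=
  ∀ y : ℕ → Fin k,
    Filter.Tendsto (fun n => ((D.C n).length : ℝ) / ((D.A y n).length))
      Filter.atTop (nhds 0)

/-- The map `T`: `T(y) = lim_n A_n` is the sequence whose `i`-th symbol is the `i`-th
symbol of `A_n` for every large `n` (the words `A_n` are nested prefixes of each other,
and `|A_{i+1}| > i`, so the `i`-th symbol of `A_{i+1}` is well defined). -/
def TData.T {k : ℕ} {P : Set (ℕ → Fin k)} (D : TData k P) (y : ℕ → Fin k) : ℕ → Fin k :=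
  fun i => if h : i < (D.A y (i + 1)).length then (D.A y (i + 1)).get ⟨i, h⟩ else y i

/-- Window of `x` of length `m` starting at `a`. -/
def win {k : ℕ} (x : ℕ → Fin k) : ℕ → ℕ → List (Fin k)
  | _, 0 => []
  | a, m + 1 => x a :: win x (a + 1) m

lemma win_length {k : ℕ} (x : ℕ → Fin k) (a m : ℕ) : (win x a m).length = m := by
  induction m generalizing a with
  | zero => rfl
  | succ m ih => simp [win, ih]

lemma win_getElem {k : ℕ} (x : ℕ → Fin k) (a m i : ℕ) (h : i < (win x a m).length) :
    (win x a m)[i] = x (a + i) := by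
  induction m generalizing a i with
  | zero => simp [win] at h
  | succ m ih =>
    cases i with
    | zero => simp [win]
    | succ i =>
      simp only [win, List.getElem_cons_succ]
      rw [ih]; congr 1; omega

lemma win_eq_iff {k : ℕ} (x : ℕ → Fin k) (a m : ℕ) (w : List (Fin k)) (hw : w.length = m) :
    win x a m = w ↔ ∀ (i : ℕ) (h : i < w.length), x (a + i) = w[i] := by
  constructor
  · rintro rfl i h
    rw [win_getElem]
  · intro h
    apply List.ext_getElem
    · rw [win_length, hw]
    · intro i h1 h2
      rw [win_getElem, h]

lemma win_eq_win {k : ℕ} (x z : ℕ → Fin k) (a b m : ℕ) :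
    win x a m = win z b m ↔ ∀ i < m, x (a + i) = z (b + i) := by
  rw [win_eq_iff _ _ _ _ (win_length _ _ _)]
  constructor
  · intro h i hi
    rw [h i (by rw [win_length]; exact hi), win_getElem]
  · intro h i hi
    rw [win_getElem]
    exact h i (by rw [win_length] at hi; exact hi)

lemma win_add {k : ℕ} (x : ℕ → Fin k) (a m n : ℕ) :
    win x a (m + n) = win x a m ++ win x (a + m) n := by
  induction m generalizing a with
  | zero => simp [win]
  | succ m ih =>
    rw [show m + 1 + n = (m + n) + 1 by omega]
    simp only [win, List.cons_append]
    rw [ih]; congr 3; omega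

lemma win_take {k : ℕ} (x : ℕ → Fin k) (a m n : ℕ) (h : m ≤ n) :
    (win x a n).take m = win x a m := by
  obtain ⟨d, rfl⟩ := Nat.exists_eq_add_of_le h
  rw [win_add, List.take_left' (win_length _ _ _)]

lemma isWordIn_iff {k : ℕ} (w : List (Fin k)) (P : Set (ℕ → Fin k)) :
    IsWordIn w P ↔ ∃ x ∈ P, win x 0 w.length = w := by
  unfold IsWordIn
  constructor
  · rintro ⟨x, hx, h⟩
    refine ⟨x, hx, (win_eq_iff _ _ _ _ rfl).2 ?_⟩
    intro i hi
    simpa using h ⟨i, hi⟩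
  · rintro ⟨x, hx, h⟩
    refine ⟨x, hx, ?_⟩
    intro i
    have := (win_eq_iff _ _ _ _ rfl).1 h i i.2
    simpa using this

lemma isWordIn_win {k : ℕ} (P : Set (ℕ → Fin k)) (x : ℕ → Fin k) (hx : x ∈ P) (m : ℕ) :
    IsWordIn (win x 0 m) P := by
  rw [isWordIn_iff]
  exact ⟨x, hx, by rw [win_length]⟩

lemma isWordIn_prefix {k : ℕ} {P : Set (ℕ → Fin k)} {u w : List (Fin k)} (h : u <+: w)
    (hw : IsWordIn w P) : IsWordIn u P := by
  rw [isWordIn_iff] at hw ⊢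
  obtain ⟨x, hx, e⟩ := hw
  refine ⟨x, hx, ?_⟩
  rw [← win_take x 0 _ _ h.length_le, e]
  exact (List.prefix_iff_eq_take.1 h).symm

lemma isWordIn_tail {k : ℕ} {P : Set (ℕ → Fin k)} (hP : IsSubshift P) {c : Fin k}
    {w : List (Fin k)} (hw : IsWordIn (c :: w) P) : IsWordIn w P := by
  obtain ⟨x, hx, e⟩ := hw
  refine ⟨shift x, hP.2.2 x hx, ?_⟩
  intro i
  have := e i.succ
  simpa [shift] using this

lemma isWordIn_suffix {k : ℕ} {P : Set (ℕ → Fin k)} (hP : IsSubshift P)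
    {u w : List (Fin k)} (h : u <:+ w) (hw : IsWordIn w P) : IsWordIn u P := by
  obtain ⟨t, rfl⟩ := h
  induction t with
  | nil => simpa using hw
  | cons c t ih => exact ih (isWordIn_tail hP hw)

lemma isWordIn_infix {k : ℕ} {P : Set (ℕ → Fin k)} (hP : IsSubshift P)
    {u w : List (Fin k)} (h : u <:+: w) (hw : IsWordIn w P) : IsWordIn u P := by
  obtain ⟨s, t, rfl⟩ := h
  exact isWordIn_suffix hP (List.suffix_append s u) (isWordIn_prefix (List.prefix_append _ t) hw)

open Classical in
/-- Number of positions of a list at which no full `m`-word of `P` starts. -/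
noncomputable def bad {k : ℕ} (P : Set (ℕ → Fin k)) (m : ℕ) : List (Fin k) → ℕ
  | [] => 0
  | c :: L => (if m ≤ L.length + 1 ∧ IsWordIn ((c :: L).take m) P then 0 else 1) + bad P m L

lemma bad_le_length {k : ℕ} (P : Set (ℕ → Fin k)) (m : ℕ) (L : List (Fin k)) :
    bad P m L ≤ L.length := by
  induction L with
  | nil => simp [bad]
  | cons c L ih =>
    simp only [bad, List.length_cons]
    split_ifs <;> omega

lemma bad_append {k : ℕ} (P : Set (ℕ → Fin k)) (m : ℕ) (L M : List (Fin k)) :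
    bad P m (L ++ M) ≤ bad P m L + bad P m M := by
  induction L with
  | nil => simp [bad]
  | cons c L ih =>
    simp only [bad, List.cons_append]
    by_cases h : m ≤ L.length + 1 ∧ IsWordIn ((c :: L).take m) P
    · have h2 : m ≤ (L ++ M).length + 1 ∧ IsWordIn ((c :: (L ++ M)).take m) P := by
        refine ⟨by rw [List.length_append]; omega, ?_⟩
        have : (c :: (L ++ M)).take m = (c :: L).take m := by
          rw [← List.cons_append, List.take_append_of_le_length (by simpa using h.1)]
        rw [this]; exact h.2
      rw [if_pos h, if_pos h2]; omega
    · rw [if_neg h]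
      split_ifs <;> omega

lemma bad_word {k : ℕ} {P : Set (ℕ → Fin k)} (hP : IsSubshift P) (m : ℕ) (L : List (Fin k))
    (hL : IsWordIn L P) : bad P m L ≤ m := by
  induction L with
  | nil => simp [bad]
  | cons c L ih =>
    by_cases h : m ≤ L.length + 1
    · have := ih (isWordIn_tail hP hL)
      simp only [bad]
      rw [if_pos ⟨h, isWordIn_prefix (List.take_prefix _ _) hL⟩]
      omega
    · have := bad_le_length P m (c :: L)
      simp only [List.length_cons] at this
      omega

/-- Potential. -/
noncomputable def pot {k : ℕ} (P : Set (ℕ → Fin k)) (m : ℕ) (δ : ℝ) (L : List (Fin k)) : ℝ :=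
  bad P m L - δ * L.length

lemma pot_append {k : ℕ} (P : Set (ℕ → Fin k)) (m : ℕ) (δ : ℝ) (L M : List (Fin k)) :
    pot P m δ (L ++ M) ≤ pot P m δ L + pot P m δ M := by
  have : (bad P m (L ++ M) : ℝ) ≤ bad P m L + bad P m M := by exact_mod_cast bad_append P m L M
  unfold pot
  rw [List.length_append]; push_cast
  linarith

lemma pot_nil {k : ℕ} (P : Set (ℕ → Fin k)) (m : ℕ) (δ : ℝ) : pot P m δ [] = 0 := by
  simp [pot, bad]

/-- Bounds for total, prefix, suffix and infix potentials. -/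
structure Bd {k : ℕ} (P : Set (ℕ → Fin k)) (m : ℕ) (δ : ℝ) (L : List (Fin k))
    (t p q M : ℝ) : Prop where
  tot : pot P m δ L ≤ t
  pre : ∀ U, U <+: L → pot P m δ U ≤ p
  suf : ∀ U, U <:+ L → pot P m δ U ≤ q
  inf : ∀ U, U <:+: L → pot P m δ U ≤ M

lemma Bd.append {k : ℕ} {P : Set (ℕ → Fin k)} {m : ℕ} {δ : ℝ} {L₁ L₂ : List (Fin k)}
    {t₁ p₁ q₁ M₁ t₂ p₂ q₂ M₂ t p q M : ℝ}
    (h₁ : Bd P m δ L₁ t₁ p₁ q₁ M₁) (h₂ : Bd P m δ L₂ t₂ p₂ q₂ M₂)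
    (ht : t₁ + t₂ ≤ t) (hp1 : p₁ ≤ p) (hp2 : t₁ + p₂ ≤ p) (hq1 : q₂ ≤ q) (hq2 : q₁ + t₂ ≤ q)
    (hM1 : M₁ ≤ M) (hM2 : M₂ ≤ M) (hM3 : q₁ + p₂ ≤ M) : Bd P m δ (L₁ ++ L₂) t p q M where
  tot := by linarith [pot_append P m δ L₁ L₂, h₁.tot, h₂.tot]
  pre := by
    rintro U ⟨V, hV⟩
    rcases List.append_eq_append_iff.1 hV with ⟨a, rfl, rfl⟩ | ⟨c, rfl, rfl⟩
    · linarith [h₁.pre U (List.prefix_append _ _)]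
    · linarith [pot_append P m δ L₁ c, h₁.tot, h₂.pre c (List.prefix_append _ _)]
  suf := by
    rintro U ⟨V, hV⟩
    rcases List.append_eq_append_iff.1 hV with ⟨a, rfl, rfl⟩ | ⟨c, rfl, rfl⟩
    · linarith [pot_append P m δ a L₂, h₂.tot, h₁.suf a (List.suffix_append _ _)]
    · linarith [h₂.suf U (List.suffix_append _ _)]
  inf := by
    intro U hU
    rcases List.infix_append_iff.1 hU with h | h | ⟨a, b, rfl, ha, hb⟩
    · linarith [h₁.inf U h]
    · linarith [h₂.inf U h]
    · linarith [pot_append P m δ a b, h₁.suf a ha, h₂.pre b hb]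

lemma Bd.mono {k : ℕ} {P : Set (ℕ → Fin k)} {m : ℕ} {δ : ℝ} {L : List (Fin k)}
    {t M : ℝ} (ht : pot P m δ L ≤ t) (h : ∀ U, U <:+: L → pot P m δ U ≤ M) :
    Bd P m δ L t M M M :=
  ⟨ht, fun U hU => h U hU.isInfix, fun U hU => h U hU.isInfix, h⟩

lemma bd_word {k : ℕ} {P : Set (ℕ → Fin k)} (hP : IsSubshift P) (m : ℕ) {δ : ℝ} (hδ : 0 < δ)
    (L : List (Fin k)) (hL : IsWordIn L P) : Bd P m δ L (m - δ * L.length) m m m := by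
  apply Bd.mono
  · unfold pot
    have : (bad P m L : ℝ) ≤ m := by exact_mod_cast bad_word hP m L hL
    linarith
  · intro U hU
    have : (bad P m U : ℝ) ≤ m := by exact_mod_cast bad_word hP m U (isWordIn_infix hP hU hL)
    have h2 : 0 ≤ δ * (U.length : ℝ) := by positivity
    unfold pot
    linarith

lemma bd_rep {k : ℕ} {P : Set (ℕ → Fin k)} (hP : IsSubshift P) (m : ℕ) {δ : ℝ} (hδ : 0 < δ)
    (Y : List (Fin k)) (hY : IsWordIn Y P) (s : ℝ) (hs : m - δ * Y.length ≤ -s) (hs0 : 0 ≤ s)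
    (r : ℕ) : Bd P m δ (List.replicate r Y).flatten (-(s * r)) m m (2 * m) := by
  have hm : (0 : ℝ) ≤ m := Nat.cast_nonneg m
  induction r with
  | zero =>
    have : ∀ U : List (Fin k), U = [] → pot P m δ U = 0 := by rintro _ rfl; exact pot_nil _ _ _
    constructor
    · simp [pot_nil]
    · intro U hU; rw [this U (by simpa using hU)]; exact hm
    · intro U hU; rw [this U (by simpa using hU)]; exact hm
    · intro U hU; rw [this U (by simpa using hU)]; linarith
  | succ r ih =>
    rw [List.replicate_succ, List.flatten_cons]
    have hr : 0 ≤ s * (r : ℝ) := by positivity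
    refine (bd_word hP m hδ Y hY).append ih ?_ ?_ ?_ ?_ ?_ ?_ ?_ ?_ <;> push_cast <;> linarith

lemma A_length {k : ℕ} {P : Set (ℕ → Fin k)} (D : TData k P) (y : ℕ → Fin k) (n : ℕ) :
    n + 1 ≤ (D.A y n).length := by
  induction n with
  | zero =>
    have := List.length_pos_iff.2 D.A1_ne
    simp only [TData.A]; omega
  | succ n ih =>
    simp only [TData.A, List.length_append]
    omega

lemma A_prefix_succ {k : ℕ} {P : Set (ℕ → Fin k)} (D : TData k P) (y : ℕ → Fin k) (n : ℕ) :
    D.A y n <+: D.A y (n + 1) := by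
  simp only [TData.A, List.append_assoc]
  exact List.prefix_append _ _

lemma A_prefix {k : ℕ} {P : Set (ℕ → Fin k)} (D : TData k P) (y : ℕ → Fin k) {n j : ℕ}
    (h : n ≤ j) : D.A y n <+: D.A y j := by
  induction j, h using Nat.le_induction with
  | base => exact List.prefix_rfl
  | succ j _ ih => exact ih.trans (A_prefix_succ D y j)

lemma T_win {k : ℕ} {P : Set (ℕ → Fin k)} (D : TData k P) (y : ℕ → Fin k) (n : ℕ) :
    win (D.T y) 0 (D.A y n).length = D.A y n := by
  rw [win_eq_iff _ _ _ _ rfl]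
  intro i hi
  have h1 : i < (D.A y (i + 1)).length := by have := A_length D y (i + 1); omega
  rw [zero_add]
  unfold TData.T
  rw [dif_pos h1]
  rcases le_total n (i + 1) with h | h
  · simpa using ((A_prefix D y h).getElem hi).symm
  · simpa using ((A_prefix D y h).getElem h1)

lemma T_win_of {k : ℕ} {P : Set (ℕ → Fin k)} (D : TData k P) (y : ℕ → Fin k) (n : ℕ)
    (U V W : List (Fin k)) (h : D.A y n = U ++ V ++ W) :
    win (D.T y) U.length V.length = V := by
  have e := T_win D y n
  rw [h, List.length_append, List.length_append, win_add, win_add] at e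
  have e1 := List.append_inj e (by simp [win_length])
  have e2 := List.append_inj e1.1 (by simp [win_length])
  simpa using e2.2

lemma prefixWord_eq {k : ℕ} (y : ℕ → Fin k) (n : ℕ) : prefixWord y n = win y 0 n := by
  symm
  rw [win_eq_iff _ _ _ _ (by simp [prefixWord])]
  intro i hi
  simp [prefixWord]

lemma bd_A {k : ℕ} {P : Set (ℕ → Fin k)} (hP : IsSubshift P) (D : TData k P)
    (y : ℕ → Fin k) (hy : y ∈ P) (m : ℕ) {δ : ℝ} (hδ : 0 < δ) (n : ℕ)
    (hn : 3 + 7 * (m : ℝ) ≤ δ / 2 * (n + 1)) (j : ℕ) (hj : n ≤ j) :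
    Bd P m δ (D.A y j) ((D.A y n).length + 2 * m) (2 * ((D.A y n).length + 2 * m))
      (2 * ((D.A y n).length + 2 * m)) (4 * ((D.A y n).length + 2 * m)) := by
  have hm : (0 : ℝ) ≤ m := Nat.cast_nonneg m
  obtain ⟨ℓ, hℓ⟩ : ∃ ℓ : ℝ, ℓ = ((D.A y n).length : ℝ) := ⟨_, rfl⟩
  rw [← hℓ]
  have hℓn : (n : ℝ) + 1 ≤ ℓ := by rw [hℓ]; exact_mod_cast A_length D y n
  have hn0 : (0 : ℝ) ≤ n := Nat.cast_nonneg n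
  induction j, hj using Nat.le_induction with
  | base =>
    have key : ∀ U, U <:+: D.A y n → pot P m δ U ≤ ℓ := by
      intro U hU
      have h1 : (bad P m U : ℝ) ≤ ℓ := by
        rw [hℓ]; exact_mod_cast (bad_le_length P m U).trans hU.length_le
      have h2 : 0 ≤ δ * (U.length : ℝ) := by positivity
      unfold pot; linarith
    constructor
    · linarith [key _ List.infix_rfl]
    · intro U hU; linarith [key U hU.isInfix]
    · intro U hU; linarith [key U hU.isInfix]
    · intro U hU; linarith [key U hU]
  | succ j hj ih =>
    have hC := bd_word hP m hδ (D.C j) (D.C_in j)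
    have hjn : (n : ℝ) ≤ j := by exact_mod_cast hj
    have hY := bd_rep hP m hδ (prefixWord y (j + 1))
      (by rw [prefixWord_eq]; exact isWordIn_win P y hy _) (δ / 2 * (n + 1))
      (by
        rw [prefixWord_eq, win_length]; push_cast
        nlinarith) (by positivity) ((D.A y j).length ^ 2)
    have hr : ℓ ^ 2 ≤ (((D.A y j).length ^ 2 : ℕ) : ℝ) := by
      rw [hℓ]; exact_mod_cast Nat.pow_le_pow_left (A_prefix D y hj).length_le 2
    set R : ℝ := (((D.A y j).length ^ 2 : ℕ) : ℝ)
    have hbig : 3 * ℓ + 7 * m ≤ δ / 2 * (n + 1) * R := by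
      have h1 : ℓ ≤ ℓ ^ 2 := by nlinarith
      have h2 : (3 + 7 * (m : ℝ)) * ℓ ≤ δ / 2 * (n + 1) * R :=
        mul_le_mul hn (h1.trans hr) (by linarith) (by positivity)
      nlinarith
    have hδC : 0 ≤ δ * ((D.C j).length : ℝ) := by positivity
    have hB := hC.append hY (t := -3 * (ℓ + 2 * m)) (p := 2 * m) (q := 2 * m) (M := 2 * m)
      (by linarith) (by linarith) (by linarith) (by linarith) (by nlinarith) (by linarith)
      (by linarith) (by linarith)
    have h1 := ih.append hB (t := -2 * (ℓ + 2 * m)) (p := 2 * (ℓ + 2 * m)) (q := ℓ + 2 * m)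
      (M := 4 * (ℓ + 2 * m))
      (by linarith) (by linarith) (by linarith) (by linarith) (by linarith) (by linarith)
      (by linarith) (by linarith)
    rw [TData.A]
    exact h1.append ih
      (by linarith) (by linarith) (by linarith) (by linarith) (by linarith) (by linarith)
      (by linarith) (by linarith)

lemma count_le_bad {k : ℕ} (P : Set (ℕ → Fin k)) (x : ℕ → Fin k) (m : ℕ) (S : Set ℕ)
    (hS : ∀ p ∈ S, ¬ IsWordIn (win x p m) P) (a N : ℕ) :
    (S ∩ Set.Ico a (a + N)).ncard ≤ bad P m (win x a N) := by
  induction N generalizing a with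
  | zero => simp [win, bad]
  | succ N ih =>
    have hfin : (S ∩ Set.Ico (a + 1) (a + 1 + N)).Finite := (Set.finite_Ico _ _).inter_of_right _
    have ih' := ih (a + 1)
    simp only [win, bad]
    split_ifs with h
    · have ha : a ∉ S := by
        intro ha
        apply hS a ha
        have h3 := h.2
        change IsWordIn (List.take m (win x a (N + 1))) P at h3
        rwa [win_take x a m (N + 1) (by rw [win_length] at h; exact h.1)] at h3
      have : S ∩ Set.Ico a (a + (N + 1)) ⊆ S ∩ Set.Ico (a + 1) (a + 1 + N) := by
        rintro p ⟨hp, h1, h2⟩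
        have : p ≠ a := by rintro rfl; exact ha hp
        exact ⟨hp, by omega, by omega⟩
      have := Set.ncard_le_ncard this hfin
      omega
    · have : S ∩ Set.Ico a (a + (N + 1)) ⊆ insert a (S ∩ Set.Ico (a + 1) (a + 1 + N)) := by
        rintro p ⟨hp, h1, h2⟩
        by_cases h : p = a
        · exact Or.inl h
        · exact Or.inr ⟨hp, by omega, by omega⟩
      have := Set.ncard_le_ncard this (hfin.insert a)
      have := Set.ncard_insert_le a (S ∩ Set.Ico (a + 1) (a + 1 + N))
      omega

lemma count_bound {k : ℕ} {P : Set (ℕ → Fin k)} (hP : IsSubshift P) (D : TData k P)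
    (y : ℕ → Fin k) (hy : y ∈ P) (m : ℕ) {δ : ℝ} (hδ : 0 < δ) (S : Set ℕ)
    (hS : ∀ p ∈ S, ¬ IsWordIn (win (D.T y) p m) P) :
    ∃ K : ℝ, ∀ a N : ℕ, ((S ∩ Set.Ico a (a + N)).ncard : ℝ) ≤ δ * N + K := by
  obtain ⟨n, hn⟩ := exists_nat_ge ((3 + 7 * (m : ℝ)) / (δ / 2))
  have hn' : 3 + 7 * (m : ℝ) ≤ δ / 2 * (n + 1) := by
    rw [div_le_iff₀ (by positivity)] at hn
    nlinarith
  refine ⟨4 * ((D.A y n).length + 2 * m), fun a N => ?_⟩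
  have hb := bd_A hP D y hy m hδ n hn' (n + (a + N)) (by omega)
  have hlen := A_length D y (n + (a + N))
  have hinf : win (D.T y) a N <:+: D.A y (n + (a + N)) := by
    obtain ⟨d, hd⟩ := Nat.exists_eq_add_of_le (show a + N ≤ (D.A y (n + (a + N))).length by omega)
    rw [← T_win D y (n + (a + N)), hd, win_add, win_add, zero_add]
    exact ⟨_, _, rfl⟩
  have h1 := hb.inf _ hinf
  have h2 : ((S ∩ Set.Ico a (a + N)).ncard : ℝ) ≤ bad P m (win (D.T y) a N) := by
    exact_mod_cast count_le_bad P (D.T y) m S hS a N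
  unfold pot at h1
  rw [win_length] at h1
  linarith

lemma banach_nonpos (S : Set ℕ)
    (h : ∀ δ > (0 : ℝ), ∃ K : ℝ, ∀ a N : ℕ, ((S ∩ Set.Ico a (a + N)).ncard : ℝ) ≤ δ * N + K) :
    banachUpperDensity S ≤ 0 := by
  apply le_of_forall_pos_le_add
  intro ε hε
  rw [zero_add]
  obtain ⟨K, hK⟩ := h (ε / 2) (by positivity)
  unfold banachUpperDensity
  have hnn : ∀ N : ℕ, 0 ≤ ⨆ a : ℕ, ((S ∩ Set.Ico a (a + N)).ncard : ℝ) / N := fun N =>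
    Real.iSup_nonneg (fun a => by positivity)
  apply Filter.limsup_le_of_le
  · exact Filter.isCoboundedUnder_le_of_le atTop (x := 0) hnn
  · obtain ⟨N0, hN0⟩ := exists_nat_ge (K / (ε / 2))
    filter_upwards [eventually_ge_atTop (N0 + 1)] with N hN
    apply ciSup_le
    intro a
    have hNpos : (0 : ℝ) < N := by exact_mod_cast (show 0 < N by omega)
    rw [div_le_iff₀ hNpos]
    rw [div_le_iff₀ (by positivity)] at hN0
    have hN' : (N0 : ℝ) ≤ N := by exact_mod_cast (show N0 ≤ N by omega)
    have := hK a N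
    nlinarith

lemma summable_dist {k : ℕ} (x y : ℕ → Fin k) :
    Summable (fun n : ℕ => if x n = y n then (0 : ℝ) else (1 / 2) ^ (n + 1)) := by
  refine Summable.of_nonneg_of_le (f := fun n => (1 / 2 : ℝ) ^ (n + 1)) ?_ ?_ ?_
  · intro n; split_ifs <;> positivity
  · intro n; split_ifs
    · positivity
    · exact le_rfl
  · exact (summable_nat_add_iff 1).2 summable_geometric_two

lemma dist_small {k : ℕ} (ε : ℝ) (hε : 0 < ε) :
    ∃ m : ℕ, ∀ x y : ℕ → Fin k, win x 0 m = win y 0 m → shiftDist x y < ε := by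
  obtain ⟨m, hm⟩ := exists_pow_lt_of_lt_one hε (show (1 / 2 : ℝ) < 1 by norm_num)
  refine ⟨m, fun x y h => lt_of_le_of_lt ?_ hm⟩
  rw [win_eq_win] at h
  unfold shiftDist
  rw [← (summable_dist x y).sum_add_tsum_nat_add m]
  rw [Finset.sum_eq_zero, zero_add]
  · have hg : HasSum (fun n : ℕ => (1 / 2 : ℝ) ^ n) 2 := hasSum_geometric_two
    have hs : HasSum (fun n : ℕ => (1 / 2 : ℝ) ^ (n + m + 1)) ((1 / 2) ^ m) := by
      have h1 := hg.mul_left ((1 / 2 : ℝ) ^ (m + 1))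
      have e1 : (1 / 2 : ℝ) ^ (m + 1) * 2 = (1 / 2) ^ m := by rw [pow_succ]; ring
      have e2 : (fun n : ℕ => (1 / 2 : ℝ) ^ (n + m + 1)) =
          fun n : ℕ => (1 / 2 : ℝ) ^ (m + 1) * (1 / 2) ^ n := by
        funext n; rw [← pow_add]; congr 1; omega
      rw [e1] at h1
      rw [e2]; exact h1
    refine hasSum_le ?_ ((summable_nat_add_iff m).2 (summable_dist x y)).hasSum hs
    intro n
    split_ifs
    · positivity
    · exact le_rfl
  · intro i hi
    have := h i (Finset.mem_range.1 hi)
    simp only [zero_add] at this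
    rw [if_pos this]

lemma dist_agree {k : ℕ} (m : ℕ) :
    ∃ ε > (0 : ℝ), ∀ x y : ℕ → Fin k, shiftDist x y < ε → win x 0 m = win y 0 m := by
  refine ⟨(1 / 2) ^ m, by positivity, fun x y h => ?_⟩
  rw [win_eq_win]
  intro i hi
  simp only [zero_add]
  by_contra hne
  have h1 := (summable_dist x y).le_tsum i (fun j _ => by split_ifs <;> positivity)
  rw [if_neg hne] at h1
  have h2 : (1 / 2 : ℝ) ^ m ≤ (1 / 2) ^ (i + 1) :=
    pow_le_pow_of_le_one (by norm_num) (by norm_num) (by omega)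
  unfold shiftDist at h
  linarith

lemma win_shift {k : ℕ} (x : ℕ → Fin k) (n m : ℕ) : win (shift^[n] x) 0 m = win x n m := by
  rw [win_eq_win]
  intro i _
  rw [zero_add]
  induction n generalizing x with
  | zero => simp
  | succ n ih =>
    rw [Function.iterate_succ_apply, ih]
    simp only [shift]; congr 1; omega

lemma T_rec {k : ℕ} {P : Set (ℕ → Fin k)} (D : TData k P) (y : ℕ → Fin k) (ε : ℝ) (hε : 0 < ε)
    (N : ℕ) : ∃ n ≥ N, shift^[n] (D.T y) ∈ sball (D.T y) ε := by
  obtain ⟨m, hm⟩ := dist_small (k := k) ε hε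
  set j := m + N
  have hl := A_length D y j
  have e := T_win_of D y (j + 1) (D.A y j ++
        (D.C j ++ (List.replicate ((D.A y j).length ^ 2) (prefixWord y (j + 1))).flatten))
        (D.A y j) [] (by rw [TData.A, List.append_nil])
  refine ⟨(D.A y j ++
        (D.C j ++ (List.replicate ((D.A y j).length ^ 2) (prefixWord y (j + 1))).flatten)).length,
        ?_, hm _ _ ?_⟩
  rotate_left
  · rw [win_shift]
    rw [← win_take _ _ m (D.A y j).length (by omega), ← win_take _ _ m (D.A y j).length (by omega),
      e, T_win]
  · rw [List.length_append]; omega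

lemma P_sub {k : ℕ} {P : Set (ℕ → Fin k)} (D : TData k P) (y z : ℕ → Fin k)
    (hz : z ∈ P) : z ∈ omegaLim (D.T y) := by
  intro ε hε N
  obtain ⟨m, hm⟩ := dist_small (k := k) ε hε
  have hex : ∀ L : ℕ, ∃ n, D.C n = win z 0 (L + 1) := fun L =>
    D.C_surj _ (by simp [win]) (isWordIn_win P z hz _)
  choose f hf using hex
  have hinj : Function.Injective (fun L => f (L + m)) := by
    intro a b hab
    have h1 := hf (a + m)
    have h2 := hf (b + m)
    dsimp only at hab
    rw [hab, h2] at h1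
    have := congrArg List.length h1
    simp only [win_length] at this
    omega
  obtain ⟨L, hL⟩ : ∃ L, N ≤ f (L + m) := by
    by_contra hcon
    push Not at hcon
    exact Set.infinite_range_of_injective hinj
      ((Set.finite_Iio N).subset (by rintro _ ⟨L, rfl⟩; exact hcon L))
  have hl := A_length D y (f (L + m))
  have e := T_win_of D y (f (L + m) + 1) (D.A y (f (L + m))) (D.C (f (L + m))) _
    (by rw [TData.A]; simp only [List.append_assoc]; rfl)
  refine ⟨(D.A y (f (L + m))).length, ?_, hm _ _ ?_⟩
  rotate_left
  · rw [win_shift]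
    rw [hf, win_length] at e
    rw [← win_take _ _ m (L + m + 1) (by omega), ← win_take _ _ m (L + m + 1) (by omega), e]
  · omega

lemma T_not_mem {k : ℕ} {P : Set (ℕ → Fin k)} (D : TData k P) (y : ℕ → Fin k) :
    D.T y ∉ P := by
  intro h
  apply D.A1_not
  have e := T_win D y 0
  simp only [TData.A] at e
  rw [← e]
  exact isWordIn_win P _ h _

lemma statOmega_sub {k : ℕ} {P : Set (ℕ → Fin k)} (hP : IsSubshift P) (D : TData k P)
    (y : ℕ → Fin k) (hy : y ∈ P) : statOmega banachUpperDensity (D.T y) ⊆ P := by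
  intro z hz
  apply hP.2.1
  intro ε hε
  by_contra hcon
  push Not at hcon
  obtain ⟨m, hm⟩ := dist_small (k := k) ε hε
  obtain ⟨η, hη, hag⟩ := dist_agree (k := k) m
  have hpos := hz η hη
  refine absurd (banach_nonpos (visits (D.T y) (sball z η)) ?_) (not_le.2 hpos)
  intro δ hδ
  refine count_bound hP D y hy m hδ _ ?_
  rintro p ⟨_, hp⟩ hw
  have e := hag _ _ hp
  rw [win_shift] at e
  rw [← e, isWordIn_iff, win_length] at hw
  obtain ⟨u, hu, hu2⟩ := hw
  exact absurd (hm z u hu2.symm) (not_lt.2 (hcon u hu))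


/-- **Proposition.** For a proper subshift `P ⊊ Σ_k` and the map `T` constructed from `P`,
for every `y ∈ P` one has `ω_{B*}(T(y)) ⊆ P ⊊ ω_σ(T(y))`; in particular `T(y)` is
recurrent but not Banach recurrent. -/
theorem T_image_recurrent_not_banachRecurrent (k : ℕ) (hk : 2 ≤ k)
    (P : Set (ℕ → Fin k)) (hP : IsSubshift P) (hproper : P ≠ Set.univ)
    (D : TData k P) (hD : D.Small) (y : ℕ → Fin k) (hy : y ∈ P) :
    statOmega banachUpperDensity (D.T y) ⊆ P ∧ P ⊂ omegaLim (D.T y) ∧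
    Recurrent (D.T y) ∧ ¬ BanachRecurrent (D.T y) := by
  have h1 := statOmega_sub hP D y hy
  refine ⟨h1, ⟨fun z hz => P_sub D y z hz, fun h => T_not_mem D y (h ?_)⟩, ?_, ?_⟩
  · intro ε hε N
    exact T_rec D y ε hε N
  · intro ε hε
    exact T_rec D y ε hε 1
  · intro h
    exact T_not_mem D y (h1 h)
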